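/- arXiv:1502.02354 — 2 statements merged into one kernel-verified Lean document; each statement's English description precedes it below -/
import Mathlib

section
/- Let 𝒜 be an abelian category, ℰ a full additive subcategory, and 𝒯 an ℰ-preresolving subcategory of 𝒜 admitting an ℰ-proper generator 𝒞. Let M be an object of 𝒜 with 𝒯-codim M = n for some n ≥ 0. Then there exists a Hom_𝒜(ℰ,−)-exact exact sequence 0 → T → N → M → 0 in 𝒜 with 𝒞-codim N ≤ n and T an object in 𝒯. -/
open CategoryTheory CategoryTheory.Limits CategoryTheory.Abelian ZeroObject

universe w v u

namespace RelHomDim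

variable {𝒜 : Type u} [Category.{v} 𝒜] [Abelian 𝒜]

/-- A class of objects of an abelian category corresponding to a full additive
subcategory: it is closed under isomorphisms, contains a zero object and is
closed under finite direct sums (biproducts). -/
def IsAdditiveClass (P : 𝒜 → Prop) : Prop :=
  P 0 ∧ (∀ ⦃X Y : 𝒜⦄, (X ≅ Y) → P X → P Y) ∧ ∀ ⦃X Y : 𝒜⦄, P X → P Y → P (X ⊞ Y)

/-- A class of objects is closed under direct summands. -/
def ClosedUnderSummands (P : 𝒜 → Prop) : Prop :=
  ∀ X Y : 𝒜, P (X ⊞ Y) → P X ∧ P Y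

/-- `Hom(W,-)`-exactness of a short exact sequence `0 → X₁ → X₂ → X₃ → 0`:
the induced sequence `0 → Hom(W,X₁) → Hom(W,X₂) → Hom(W,X₃) → 0` is exact. -/
def CovHomExact (W : 𝒜) (S : ShortComplex 𝒜) : Prop :=
  (∀ a b : W ⟶ S.X₁, a ≫ S.f = b ≫ S.f → a = b) ∧
  (∀ b : W ⟶ S.X₂, b ≫ S.g = 0 → ∃ a : W ⟶ S.X₁, a ≫ S.f = b) ∧
  (∀ c : W ⟶ S.X₃, ∃ b : W ⟶ S.X₂, b ≫ S.g = c)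

/-- A short exact sequence is `ℰ`-proper (i.e. `Hom(ℰ,-)`-exact) if it is
`Hom(E,-)`-exact for every object `E` in the class `ℰ`. -/
def EProper (E : 𝒜 → Prop) (S : ShortComplex 𝒜) : Prop :=
  ∀ W, E W → CovHomExact W S

/-- `ResW P W n K A` holds iff there is an exact sequence
`0 → K → X_{n-1} → ⋯ → X_0 → A → 0` in `𝒜` with all the `n` middle terms `X i`
in `P`, such that each of the short exact sequences obtained by splicing
satisfies `W` (this encodes, e.g., `Hom(ℰ,-)`-exactness of the whole sequence). -/
def ResW (P : 𝒜 → Prop) (W : ShortComplex 𝒜 → Prop) : ℕ → 𝒜 → 𝒜 → Prop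
  | 0 => fun K A => Nonempty (K ≅ A)
  | n + 1 => fun K A => ∃ (B X : 𝒜) (f : B ⟶ X) (g : X ⟶ A) (w : f ≫ g = 0),
      P X ∧ (ShortComplex.mk f g w).ShortExact ∧ W (ShortComplex.mk f g w) ∧
      ResW P W n K B

/-- `Res P n K A` : there is an exact sequence `0 → K → X_{n-1} → ⋯ → X_0 → A → 0`
with all middle terms in `P`. -/
abbrev Res (P : 𝒜 → Prop) : ℕ → 𝒜 → 𝒜 → Prop := ResW P fun _ => True

/-- `CoresW P W n A K` holds iff there is an exact sequence
`0 → A → X^0 → ⋯ → X^{n-1} → K → 0` with all middle terms in `P` and each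
spliced short exact piece satisfying `W`. -/
def CoresW (P : 𝒜 → Prop) (W : ShortComplex 𝒜 → Prop) : ℕ → 𝒜 → 𝒜 → Prop
  | 0 => fun A K => Nonempty (A ≅ K)
  | n + 1 => fun A K => ∃ (X B : 𝒜) (f : A ⟶ X) (g : X ⟶ B) (w : f ≫ g = 0),
      P X ∧ (ShortComplex.mk f g w).ShortExact ∧ W (ShortComplex.mk f g w) ∧
      CoresW P W n B K

/-- `Cores P n A K` : there is an exact sequence `0 → A → X^0 → ⋯ → X^{n-1} → K → 0`
with all middle terms in `P`. -/
abbrev Cores (P : 𝒜 → Prop) : ℕ → 𝒜 → 𝒜 → Prop := CoresW P fun _ => True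

/-- The `P`-dimension of `A` : the infimum of the `n ≥ 0` such that there is
an exact sequence `0 → C_n → ⋯ → C_1 → C_0 → A → 0` with all `C_i` in `P`
(`⊤ = ∞` if there is no such `n`). -/
noncomputable def rdim (P : 𝒜 → Prop) (A : 𝒜) : ℕ∞ :=
  sInf {c : ℕ∞ | ∃ n : ℕ, c = n ∧ ∃ K, P K ∧ Res P n K A}

/-- The `P`-codimension of `A` : the infimum of the `n ≥ 0` such that there is
an exact sequence `0 → A → C^0 → C^1 → ⋯ → C^n → 0` with all `C^i` in `P`
(`⊤ = ∞` if there is no such `n`). -/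
noncomputable def rcodim (P : 𝒜 → Prop) (A : 𝒜) : ℕ∞ :=
  sInf {c : ℕ∞ | ∃ n : ℕ, c = n ∧ ∃ K, P K ∧ Cores P n A K}

/-- `A` belongs to `P^⊥`, i.e. `Ext^i(C, A) = 0` for all `C` in `P` and `i ≥ 1`. -/
def MemRightPerp [HasExt.{w} 𝒜] (P : 𝒜 → Prop) (A : 𝒜) : Prop :=
  ∀ C, P C → ∀ i : ℕ, 1 ≤ i → Subsingleton (Abelian.Ext C A i)

/-- `A` belongs to `^⊥P`, i.e. `Ext^i(A, C) = 0` for all `C` in `P` and `i ≥ 1`. -/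
def MemLeftPerp [HasExt.{w} 𝒜] (P : 𝒜 → Prop) (A : 𝒜) : Prop :=
  ∀ C, P C → ∀ i : ℕ, 1 ≤ i → Subsingleton (Abelian.Ext A C i)

/-- `𝒞` is an `ℰ`-proper generator for `𝒯` (`𝒞 ⊆ 𝒯` and every object of `𝒯`
is an `ℰ`-proper quotient of an object of `𝒞` with kernel in `𝒯`). -/
def IsProperGenerator (E C T : 𝒜 → Prop) : Prop :=
  (∀ ⦃X⦄, C X → T X) ∧
  ∀ X, T X → ∃ (X' Cb : 𝒜) (f : X' ⟶ Cb) (g : Cb ⟶ X) (w : f ≫ g = 0),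
    C Cb ∧ T X' ∧ (ShortComplex.mk f g w).ShortExact ∧ EProper E (ShortComplex.mk f g w)

/-- `𝒞` is a cogenerator for `𝒯`. -/
def IsCogenerator (C T : 𝒜 → Prop) : Prop :=
  (∀ ⦃X⦄, C X → T X) ∧
  ∀ X, T X → ∃ (Cb X' : 𝒜) (f : X ⟶ Cb) (g : Cb ⟶ X') (w : f ≫ g = 0),
    C Cb ∧ T X' ∧ (ShortComplex.mk f g w).ShortExact

/-- `𝒯` is closed under `ℰ`-proper extensions. -/
def ClosedUnderProperExtensions (E T : 𝒜 → Prop) : Prop :=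
  ∀ S : ShortComplex 𝒜, S.ShortExact → EProper E S → T S.X₁ → T S.X₃ → T S.X₂

/-- `𝒯` is closed under kernels of `ℰ`-proper epimorphisms. -/
def ClosedUnderProperKernels (E T : 𝒜 → Prop) : Prop :=
  ∀ S : ShortComplex 𝒜, S.ShortExact → EProper E S → T S.X₂ → T S.X₃ → T S.X₁

/-- `𝒯` is an `ℰ`-preresolving subcategory with `ℰ`-proper generator `𝒞`. -/
def IsPreresolving (E T C : 𝒜 → Prop) : Prop :=
  IsProperGenerator E C T ∧ ClosedUnderProperExtensions E T


/-- Exactness of a four-term sequence `0 → M → T₁ → T₀ → A → 0`. -/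
def FourTermExact {M T1 T0 A : 𝒜} (f : M ⟶ T1) (g : T1 ⟶ T0) (h : T0 ⟶ A) : Prop :=
  Mono f ∧ Epi h ∧ ∃ (w₁ : f ≫ g = 0) (w₂ : g ≫ h = 0),
    (ShortComplex.mk f g w₁).Exact ∧ (ShortComplex.mk g h w₂).Exact

/-- `Hom(W,-)`-exactness of the four-term exact sequence `0 → M → T₁ → T₀ → A → 0` :
the induced sequence `0 → Hom(W,M) → Hom(W,T₁) → Hom(W,T₀) → Hom(W,A) → 0` is exact. -/
def CovHomExact4 (W : 𝒜) {M T1 T0 A : 𝒜} (f : M ⟶ T1) (g : T1 ⟶ T0) (h : T0 ⟶ A) : Prop :=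
  (∀ a b : W ⟶ M, a ≫ f = b ≫ f → a = b) ∧
  (∀ b : W ⟶ T1, b ≫ g = 0 → ∃ a : W ⟶ M, a ≫ f = b) ∧
  (∀ c : W ⟶ T0, c ≫ h = 0 → ∃ b : W ⟶ T1, b ≫ g = c) ∧
  (∀ d : W ⟶ A, ∃ c : W ⟶ T0, c ≫ h = d)

/-- There is an exact sequence `0 → M → K⁰ → C¹ → ⋯ → Cⁿ → 0` with `K⁰` in `T`
and all `C^i` in `C`. -/
def MixedCores (T C : 𝒜 → Prop) : ℕ → 𝒜 → Prop
  | 0 => fun M => ∃ K, T K ∧ Nonempty (M ≅ K)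
  | n + 1 => fun M => ∃ (K H : 𝒜) (f : M ⟶ K) (g : K ⟶ H) (w : f ≫ g = 0),
      T K ∧ (ShortComplex.mk f g w).ShortExact ∧ ∃ K', C K' ∧ Cores C n H K'

/-- The Gorenstein subcategory `𝒢(𝒞)` : objects `A` admitting a doubly infinite
exact sequence `⋯ → X_{-1} → X_0 → X_1 → ⋯` with all terms in `𝒞`, which is both
`Hom(𝒞,-)`-exact and `Hom(-,𝒞)`-exact, such that `A ≅ Im(X_0 → X_1)`. -/
def IsGorenstein (P : 𝒜 → Prop) (A : 𝒜) : Prop :=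
  ∃ (X : ℤ → 𝒜) (d : ∀ i : ℤ, X i ⟶ X (i + 1)) (w : ∀ i, d i ≫ d (i + 1) = 0),
    (∀ i, P (X i)) ∧
    (∀ i, (ShortComplex.mk (d i) (d (i + 1)) (w i)).Exact) ∧
    (∀ C, P C → ∀ (i : ℤ) (f : C ⟶ X (i + 1)), f ≫ d (i + 1) = 0 →
      ∃ g : C ⟶ X i, g ≫ d i = f) ∧
    (∀ C, P C → ∀ (i : ℤ) (f : X (i + 1) ⟶ C), d i ≫ f = 0 →
      ∃ g : X (i + 1 + 1) ⟶ C, d (i + 1) ≫ g = f) ∧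
    Nonempty (A ≅ Limits.image (d 0))

end RelHomDim

namespace RelHomDim

variable {𝒜 : Type u} [Category.{v} 𝒜] [Abelian 𝒜]

theorem covHomExact_of_shortExact {S : ShortComplex 𝒜} (hS : S.ShortExact) {W : 𝒜}
    (h : ∀ c : W ⟶ S.X₃, ∃ b : W ⟶ S.X₂, b ≫ S.g = c) : CovHomExact W S := by
  have := hS.mono_f
  exact ⟨fun a b hab => (cancel_mono S.f).1 hab,
    fun b hb => ⟨hS.exact.lift b hb, hS.exact.lift_f b hb⟩, h⟩

/-- A short exact sequence pulls back along any morphism to its right-hand term. -/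
theorem shortExact_of_isPullback {X₁ X₂ X₃ Y P : 𝒜} {f : X₁ ⟶ X₂} {g : X₂ ⟶ X₃} {w : f ≫ g = 0}
    (hS : (ShortComplex.mk f g w).ShortExact) {p : P ⟶ X₂} {q : P ⟶ Y} {h : Y ⟶ X₃}
    (sq : IsPullback p q g h) :
    ∃ (f' : X₁ ⟶ P) (w' : f' ≫ q = 0), (ShortComplex.mk f' q w').ShortExact := by
  have : Mono f := hS.mono_f
  have : Epi g := hS.epi_g
  have hq : Epi q := (MorphismProperty.epimorphisms 𝒜).of_isPullback sq
    (MorphismProperty.epimorphisms.infer_property g)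
  refine ⟨sq.lift f 0 (by simp [w]), sq.lift_snd _ _ _, ?_⟩
  have hm : Mono (sq.lift f 0 (by simp [w])) :=
    mono_of_mono_fac (sq.lift_fst f 0 (by simp [w]))
  have hex : (ShortComplex.mk (sq.lift f 0 (by simp [w])) q (sq.lift_snd _ _ _)).Exact := by
    refine ShortComplex.exact_of_f_is_kernel _ (KernelFork.IsLimit.ofι' _ _ fun {A} k hk => ?_)
    have hk' : (k ≫ p) ≫ g = 0 := by
      rw [Category.assoc, sq.w, reassoc_of% hk, zero_comp]
    refine ⟨hS.exact.lift (k ≫ p) hk', sq.hom_ext ?_ ?_⟩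
    · simpa using hS.exact.lift_f (k ≫ p) hk'
    · simpa using hk.symm
  exact { exact := hex, mono_f := hm, epi_g := hq }

/-- An `E`-proper short exact sequence pulls back to an `E`-proper short exact sequence. -/
theorem eProper_of_isPullback {E : 𝒜 → Prop} {X₁ X₂ X₃ Y P : 𝒜} {f : X₁ ⟶ X₂} {g : X₂ ⟶ X₃}
    {w : f ≫ g = 0} (hE : EProper E (ShortComplex.mk f g w)) {p : P ⟶ X₂} {q : P ⟶ Y} {h : Y ⟶ X₃}
    (sq : IsPullback p q g h) {f' : X₁ ⟶ P} {w' : f' ≫ q = 0}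
    (hS' : (ShortComplex.mk f' q w').ShortExact) : EProper E (ShortComplex.mk f' q w') := by
  refine fun W hW => covHomExact_of_shortExact hS' fun c => ?_
  obtain ⟨b, hb⟩ := (hE W hW).2.2 (c ≫ h)
  exact ⟨sq.lift b c hb, sq.lift_snd _ _ _⟩

/-- Pulling back the kernel `i` of `r` along an epimorphism `g` yields the kernel of `g ≫ r`. -/
theorem shortExact_comp_of_isPullback {X₁ X₂ X₃ Y P : 𝒜} {i : X₁ ⟶ X₂} {r : X₂ ⟶ X₃}
    {w : i ≫ r = 0} (hS : (ShortComplex.mk i r w).ShortExact) {p : P ⟶ Y} {q : P ⟶ X₁}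
    {g : Y ⟶ X₂} [Epi g] (sq : IsPullback p q g i) :
    ∃ w' : p ≫ g ≫ r = 0, (ShortComplex.mk p (g ≫ r) w').ShortExact := by
  have : Mono i := hS.mono_f
  have : Epi r := hS.epi_g
  have hp : Mono p := (MorphismProperty.monomorphisms 𝒜).of_isPullback sq.flip
    (MorphismProperty.monomorphisms.infer_property i)
  have w' : p ≫ g ≫ r = 0 := by rw [reassoc_of% sq.w, w, comp_zero]
  have hex : (ShortComplex.mk p (g ≫ r) w').Exact := by
    refine ShortComplex.exact_of_f_is_kernel _ (KernelFork.IsLimit.ofι' _ _ fun {A} k hk => ?_)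
    have hk' : (k ≫ g) ≫ r = 0 := by simpa using hk
    exact ⟨sq.lift k (hS.exact.lift (k ≫ g) hk') (hS.exact.lift_f (k ≫ g) hk').symm,
      sq.lift_fst _ _ _⟩
  exact ⟨w', { exact := hex, mono_f := hp, epi_g := epi_comp g r }⟩

/-- If `A` has a finite `T`-coresolution of length `n`, then it is an `E`-proper quotient, with
kernel in `T`, of an object with a `C`-coresolution of length `n`. -/
theorem IsPreresolving.exists_eProper_of_cores {E T C : 𝒜 → Prop} (hT : IsAdditiveClass T)
    (hpre : IsPreresolving E T C) (n : ℕ) (A K : 𝒜) (hK : T K) (hA : Cores T n A K) :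
    ∃ (X N : 𝒜) (f : X ⟶ N) (g : N ⟶ A) (w : f ≫ g = 0),
      T X ∧ (ShortComplex.mk f g w).ShortExact ∧ EProper E (ShortComplex.mk f g w) ∧
      ∃ L, C L ∧ Cores C n N L := by
  induction n generalizing A with
  | zero =>
    obtain ⟨e⟩ := hA
    obtain ⟨X, N, f, g, w, hN, hX, hS, hE⟩ := hpre.1.2 A (hT.2.1 e.symm hK)
    exact ⟨X, N, f, g, w, hX, hS, hE, N, hN, ⟨Iso.refl N⟩⟩
  | succ n ih =>
    obtain ⟨Y, B, i, r, w, hY, hS, -, hB⟩ := hA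
    obtain ⟨X', N', f', g', w', hX', hS', hE', L, hL, hN'⟩ := ih B hB
    have sq := IsPullback.of_hasPullback g' r
    obtain ⟨a, wa, ha⟩ := shortExact_of_isPullback hS' sq
    have hP := hpre.2 _ ha (eProper_of_isPullback hE' sq ha) hX' hY
    obtain ⟨b, wb, hb⟩ := shortExact_of_isPullback hS sq.flip
    obtain ⟨X, D, f, g, wg, hD, hX, hg, hEg⟩ := hpre.1.2 _ hP
    have : Epi g := hg.epi_g
    have sq' := IsPullback.of_hasPullback g b
    obtain ⟨c, wc, hc⟩ := shortExact_of_isPullback hg sq'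
    obtain ⟨wd, hd⟩ := shortExact_comp_of_isPullback hb sq'
    exact ⟨X, _, c, _, wc, hX, hc, eProper_of_isPullback hEg sq' hc, L, hL,
      D, N', _, _, wd, hD, hd, trivial, hN'⟩

theorem exists_cores_of_rcodim_eq {P : 𝒜 → Prop} {A : 𝒜} {n : ℕ} (h : rcodim P A = n) :
    ∃ K, P K ∧ Cores P n A K := by
  have hne : {c : ℕ∞ | ∃ n : ℕ, c = n ∧ ∃ K, P K ∧ Cores P n A K}.Nonempty := by
    by_contra hempty
    rw [rcodim, Set.not_nonempty_iff_eq_empty.1 hempty, sInf_empty] at h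
    exact ENat.top_ne_natCast n h
  obtain ⟨m, hm, hK⟩ := csInf_mem hne
  obtain rfl : n = m := by exact_mod_cast h.symm.trans hm
  exact hK

end RelHomDim

open RelHomDim in
/-- Corollary 3.5. -/
theorem stmt7 {𝒜 : Type u} [Category.{v} 𝒜] [Abelian 𝒜]
    (ℰ 𝒯 𝒞 : 𝒜 → Prop) (hℰ : IsAdditiveClass ℰ) (h𝒯 : IsAdditiveClass 𝒯)
    (h𝒞 : IsAdditiveClass 𝒞) (hpre : IsPreresolving ℰ 𝒯 𝒞)
    (n : ℕ) (M : 𝒜) (hM : rcodim 𝒯 M = (n : ℕ∞)) :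
    ∃ (T N : 𝒜) (f : T ⟶ N) (g : N ⟶ M) (w : f ≫ g = 0),
      𝒯 T ∧ (ShortComplex.mk f g w).ShortExact ∧
      EProper ℰ (ShortComplex.mk f g w) ∧ rcodim 𝒞 N ≤ (n : ℕ∞) := by
  obtain ⟨K, hK, hMK⟩ := exists_cores_of_rcodim_eq hM
  obtain ⟨T, N, f, g, w, hT, hS, hE, hN⟩ := hpre.exists_eProper_of_cores h𝒯 n M K hK hMK
  exact ⟨T, N, f, g, w, hT, hS, hE, sInf_le ⟨n, rfl, hN⟩⟩
end

section
/- Let 𝒜 be an abelian category and 𝒯 a 𝒞-resolving subcategory of 𝒜 with 𝒞-proper generator 𝒞 and 𝒯 ⊆ 𝒞^⊥. If 𝒯 is closed under direct summands, then for every n ≥ 0 the class of objects of 𝒜 with 𝒯-dimension at most n is closed under direct summands. -/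
open CategoryTheory CategoryTheory.Limits CategoryTheory.Abelian ZeroObject

universe w v u

namespace RelHomDim

section Sequences

variable {𝒜 : Type u} [Category.{v} 𝒜] [Abelian 𝒜]

/-- A kernel-type lifting property at `f` and epimorphy of `g` give a short exact sequence. -/
lemma shortExact_of_lift {A B C : 𝒜} (f : A ⟶ B) (g : B ⟶ C) (w : f ≫ g = 0) [Mono f] [Epi g]
    (h : ∀ ⦃W : 𝒜⦄ (t : W ⟶ B), t ≫ g = 0 → ∃ l : W ⟶ A, l ≫ f = t) :
    (ShortComplex.mk f g w).ShortExact where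
  exact := ShortComplex.exact_of_f_is_kernel _
    (KernelFork.IsLimit.ofι' f w fun t ht ↦ ⟨(h t ht).choose, (h t ht).choose_spec⟩)

lemma exists_lift_of_shortExact {A B C W : 𝒜} {f : A ⟶ B} {g : B ⟶ C} {w : f ≫ g = 0}
    (h : (ShortComplex.mk f g w).ShortExact) (t : W ⟶ B) (ht : t ≫ g = 0) :
    ∃ l : W ⟶ A, l ≫ f = t := by
  have : Mono f := h.mono_f
  exact ⟨h.exact.lift t ht, h.exact.lift_f t ht⟩

/-- The base change of a short exact sequence along a morphism to its third term. -/
lemma shortExact_pullback {K C A D : 𝒜} {f : K ⟶ C} {g : C ⟶ A} {w : f ≫ g = 0}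
    (h : (ShortComplex.mk f g w).ShortExact) (d : D ⟶ A) :
    (ShortComplex.mk (pullback.lift f 0 (by rw [w, zero_comp]) : K ⟶ pullback g d)
      (pullback.snd g d) (pullback.lift_snd _ _ _)).ShortExact := by
  have : Mono f := h.mono_f
  have : Epi g := h.epi_g
  have : Mono (pullback.lift f 0 (by rw [w, zero_comp]) : K ⟶ pullback g d) :=
    mono_of_mono_fac (pullback.lift_fst _ _ _)
  refine shortExact_of_lift _ _ _ fun W t ht ↦ ?_
  obtain ⟨l, hl⟩ := exists_lift_of_shortExact h (t ≫ pullback.fst g d) (by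
    rw [Category.assoc, pullback.condition, reassoc_of% ht, zero_comp])
  refine ⟨l, ?_⟩
  apply pullback.hom_ext
  · rw [Category.assoc, pullback.lift_fst, hl]
  · rw [Category.assoc, pullback.lift_snd, comp_zero, ht]

/-- The kernel of a composite `C ⟶ X ⟶ A` of epimorphisms is the pullback of the kernel of
`X ⟶ A` along `C ⟶ X`. -/
lemma shortExact_pullback_comp {K X A C : 𝒜} {f : K ⟶ X} {g : X ⟶ A} {w : f ≫ g = 0}
    (h : (ShortComplex.mk f g w).ShortExact) (p : C ⟶ X) [Epi p] :
    (ShortComplex.mk (pullback.fst p f) (p ≫ g) (by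
      rw [pullback.condition_assoc, w, comp_zero])).ShortExact := by
  have : Mono f := h.mono_f
  have : Epi g := h.epi_g
  refine shortExact_of_lift _ _ _ fun W t ht ↦ ?_
  obtain ⟨l, hl⟩ := exists_lift_of_shortExact h (t ≫ p) (by rw [Category.assoc, ht])
  exact ⟨pullback.lift t l hl.symm, pullback.lift_fst _ _ _⟩

lemma shortExact_kernel {X Y : 𝒜} (g : X ⟶ Y) [Epi g] :
    (ShortComplex.mk (kernel.ι g) g (kernel.condition g)).ShortExact :=
  shortExact_of_lift _ _ _ fun _ t ht ↦ ⟨kernel.lift g t ht, kernel.lift_ι _ _ _⟩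

lemma shortExact_biprod_map {A B C A' B' C' : 𝒜} {f : A ⟶ B} {g : B ⟶ C} {w : f ≫ g = 0}
    {f' : A' ⟶ B'} {g' : B' ⟶ C'} {w' : f' ≫ g' = 0}
    (h : (ShortComplex.mk f g w).ShortExact) (h' : (ShortComplex.mk f' g' w').ShortExact) :
    (ShortComplex.mk (biprod.map f f') (biprod.map g g') (by
      ext <;> simp [w, w'])).ShortExact := by
  have : Mono f := h.mono_f
  have : Epi g := h.epi_g
  have : Mono f' := h'.mono_f
  have : Epi g' := h'.epi_g
  refine shortExact_of_lift _ _ _ fun W t ht ↦ ?_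
  obtain ⟨l, hl⟩ := exists_lift_of_shortExact h (t ≫ biprod.fst) (by
    simpa using ht =≫ biprod.fst)
  obtain ⟨l', hl'⟩ := exists_lift_of_shortExact h' (t ≫ biprod.snd) (by
    simpa using ht =≫ biprod.snd)
  refine ⟨biprod.lift l l', ?_⟩
  apply biprod.hom_ext
  · simpa using hl
  · simpa using hl'

/-- If `d : D ⟶ A` factors through `g : C ⟶ A`, then the pullback of `g` and `d` is the
biproduct of the kernel of `g` and `D`. -/
lemma nonempty_pullback_iso_biprod {K C A D : 𝒜} {f : K ⟶ C} {g : C ⟶ A} {w : f ≫ g = 0}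
    (h : (ShortComplex.mk f g w).ShortExact) (d : D ⟶ A) (s : D ⟶ C) (hs : s ≫ g = d) :
    Nonempty (pullback g d ≅ K ⊞ D) :=
  have h' := shortExact_pullback h d
  ⟨(ShortComplex.Splitting.ofExactOfSection _ h'.exact
    (pullback.lift s (𝟙 D) (by rw [hs, Category.id_comp])) (pullback.lift_snd _ _ _)
    h'.mono_f).isoBinaryBiproduct⟩

/-- Schanuel's lemma, for two epimorphisms onto `A` which factor through each other. -/
lemma schanuel {K C L D A : 𝒜} {f : K ⟶ C} {g : C ⟶ A} {w : f ≫ g = 0}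
    {f' : L ⟶ D} {g' : D ⟶ A} {w' : f' ≫ g' = 0}
    (h : (ShortComplex.mk f g w).ShortExact) (h' : (ShortComplex.mk f' g' w').ShortExact)
    (s : D ⟶ C) (hs : s ≫ g = g') (t : C ⟶ D) (ht : t ≫ g' = g) :
    Nonempty (K ⊞ D ≅ L ⊞ C) := by
  obtain ⟨e⟩ := nonempty_pullback_iso_biprod h g' s hs
  obtain ⟨e'⟩ := nonempty_pullback_iso_biprod h' g t ht
  exact ⟨e.symm ≪≫ pullbackSymmetry _ _ ≪≫ e'⟩

end Sequences

section Dimension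

variable {𝒜 : Type u} [Category.{v} 𝒜] [Abelian 𝒜] {T : 𝒜 → Prop}

/-- There is an exact sequence `0 → X_n → ⋯ → X_0 → A → 0` with all terms `X_i` in `T`. -/
def DimLE (T : 𝒜 → Prop) : ℕ → 𝒜 → Prop
  | 0 => T
  | n + 1 => fun A => ∃ (K X : 𝒜) (f : K ⟶ X) (g : X ⟶ A) (w : f ≫ g = 0),
      T X ∧ (ShortComplex.mk f g w).ShortExact ∧ DimLE T n K

lemma dimLE_iff_res (hT : IsAdditiveClass T) (n : ℕ) (A : 𝒜) :
    DimLE T n A ↔ ∃ K, T K ∧ Res T n K A := by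
  induction n generalizing A with
  | zero => exact ⟨fun h ↦ ⟨A, h, ⟨Iso.refl _⟩⟩, fun ⟨K, hK, ⟨e⟩⟩ ↦ hT.2.1 e hK⟩
  | succ n ih =>
    constructor
    · rintro ⟨B, X, f, g, w, hX, h, hB⟩
      obtain ⟨K, hK, r⟩ := (ih B).1 hB
      exact ⟨K, hK, B, X, f, g, w, hX, h, trivial, r⟩
    · rintro ⟨K, hK, B, X, f, g, w, hX, h, -, r⟩
      exact ⟨B, X, f, g, w, hX, h, (ih B).2 ⟨K, hK, r⟩⟩

lemma DimLE.of_iso (hT : IsAdditiveClass T) {n : ℕ} {A B : 𝒜} (e : A ≅ B) (h : DimLE T n A) :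
    DimLE T n B := by
  cases n with
  | zero => exact hT.2.1 e h
  | succ n =>
    obtain ⟨K, X, f, g, w, hX, h, hK⟩ := h
    refine ⟨K, X, f, g ≫ e.hom, by rw [reassoc_of% w, zero_comp], hX, ?_, hK⟩
    exact ShortComplex.shortExact_of_iso (S₁ := ShortComplex.mk f g w)
      (ShortComplex.isoMk (Iso.refl _) (Iso.refl _) e (by simp) (by simp)) h

lemma DimLE.succ (hT : IsAdditiveClass T) {n : ℕ} {A : 𝒜} (h : DimLE T n A) :
    DimLE T (n + 1) A := by
  induction n generalizing A with
  | zero =>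
    refine ⟨0, A, 0, 𝟙 A, by simp, h, ?_, hT.1⟩
    exact shortExact_of_lift _ _ _ fun W t ht ↦ ⟨0, by simpa using ht.symm⟩
  | succ n ih =>
    obtain ⟨K, X, f, g, w, hX, h, hK⟩ := h
    exact ⟨K, X, f, g, w, hX, h, ih hK⟩

lemma rdim_le_iff (hT : IsAdditiveClass T) (n : ℕ) (A : 𝒜) :
    rdim T A ≤ n ↔ DimLE T n A := by
  constructor
  · intro h
    have hne : {c : ℕ∞ | ∃ m : ℕ, c = m ∧ ∃ K, T K ∧ Res T m K A}.Nonempty := by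
      by_contra! hne
      rw [rdim, hne, sInf_empty, top_le_iff] at h
      exact ENat.natCast_ne_top n h
    obtain ⟨m, hm, hA⟩ := csInf_mem hne
    rw [rdim, hm, Nat.cast_le] at h
    exact Nat.le_induction ((dimLE_iff_res hT m A).2 hA) (fun _ _ h ↦ h.succ hT) n h
  · exact fun h ↦ sInf_le ⟨n, rfl, (dimLE_iff_res hT n A).1 h⟩

variable {C : 𝒜 → Prop}

lemma DimLE.exists_generator_of_extension (hpre : IsPreresolving C T C) {n : ℕ}
    (hext : ∀ {T' E K : 𝒜} {f : T' ⟶ E} {g : E ⟶ K} {w : f ≫ g = 0},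
      (ShortComplex.mk f g w).ShortExact → T T' → DimLE T n K → DimLE T n E)
    {A : 𝒜} (h : DimLE T (n + 1) A) :
    ∃ (K X : 𝒜) (f : K ⟶ X) (g : X ⟶ A) (w : f ≫ g = 0),
      C X ∧ (ShortComplex.mk f g w).ShortExact ∧ DimLE T n K := by
  obtain ⟨K, X, f, g, w, hX, h, hK⟩ := h
  obtain ⟨T', Y, i, p, wp, hY, hT', hp, -⟩ := hpre.1.2 X hX
  have : Epi p := hp.epi_g
  exact ⟨pullback p f, Y, pullback.fst p f, p ≫ g, _, hY, shortExact_pullback_comp h p,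
    hext (shortExact_pullback hp f) hT' hK⟩

variable [HasExt.{w} 𝒜]

lemma eProper_of_memRightPerp {S : ShortComplex 𝒜} (hS : S.ShortExact)
    (h : MemRightPerp C S.X₁) : EProper C S := by
  intro W hW
  have : Mono S.f := hS.mono_f
  refine ⟨fun a b hab ↦ (cancel_mono S.f).1 hab,
    fun b hb ↦ exists_lift_of_shortExact hS b hb, fun c ↦ ?_⟩
  have := h W hW 1 le_rfl
  obtain ⟨x, hx⟩ := Ext.covariant_sequence_exact₃ W hS (Ext.mk₀ c) (zero_add 1)
    (Subsingleton.elim _ _)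
  obtain ⟨b, rfl⟩ := Ext.homEquiv₀.symm.surjective x
  refine ⟨b, Ext.homEquiv₀.symm.injective ?_⟩
  exact (Ext.mk₀_comp_mk₀ b S.g).symm.trans hx

lemma DimLE.memRightPerp (hsub : ∀ X : 𝒜, T X → MemRightPerp C X) {n : ℕ} {A : 𝒜}
    (h : DimLE T n A) : MemRightPerp C A := by
  induction n generalizing A with
  | zero => exact hsub A h
  | succ n ih =>
    obtain ⟨K, X, f, g, w, hX, h, hK⟩ := h
    refine fun W hW i hi ↦ subsingleton_of_forall_eq 0 fun x ↦ ?_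
    have := hsub X hX W hW i hi
    have := ih hK W hW (i + 1) (by lia)
    obtain ⟨y, rfl⟩ := Ext.covariant_sequence_exact₃ W h x rfl (Subsingleton.elim _ _)
    rw [Subsingleton.elim y 0, Ext.zero_comp]

/-- An extension of an object of `T`-dimension at most `n` by an object of `T` has `T`-dimension
at most `n`. -/
lemma DimLE.extension (hT : IsAdditiveClass T) (hpre : IsPreresolving C T C)
    (hsub : ∀ X : 𝒜, T X → MemRightPerp C X) {n : ℕ}
    {T' E K : 𝒜} {f : T' ⟶ E} {g : E ⟶ K} {w : f ≫ g = 0}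
    (h : (ShortComplex.mk f g w).ShortExact) (hT' : T T') (hK : DimLE T n K) :
    DimLE T n E := by
  induction n generalizing T' E K with
  | zero => exact hpre.2 _ h (eProper_of_memRightPerp h (hsub _ hT')) hT' hK
  | succ n ih =>
    obtain ⟨K₁, X, i, p, wp, hX, hp, hK₁⟩ := hK.exists_generator_of_extension hpre ih
    have hP := shortExact_pullback h p
    have hP' := shortExact_pullback hp g
    exact ⟨K₁, pullback p g, _, _, _, hT.2.1 (pullbackSymmetry g p)
      (hpre.2 _ hP (eProper_of_memRightPerp hP (hsub _ hT')) hT' (hpre.1.1 hX)), hP', hK₁⟩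

/-- An object of `T`-dimension at most `n + 1` is a quotient of an object of the generator `C`
by an object of `T`-dimension at most `n`. -/
lemma DimLE.exists_generator (hT : IsAdditiveClass T) (hpre : IsPreresolving C T C)
    (hsub : ∀ X : 𝒜, T X → MemRightPerp C X) {n : ℕ} {A : 𝒜} (h : DimLE T (n + 1) A) :
    ∃ (K X : 𝒜) (f : K ⟶ X) (g : X ⟶ A) (w : f ≫ g = 0),
      C X ∧ (ShortComplex.mk f g w).ShortExact ∧ DimLE T n K :=
  h.exists_generator_of_extension hpre (DimLE.extension hT hpre hsub)

lemma DimLE.biprod (hT : IsAdditiveClass T) (hpre : IsPreresolving C T C)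
    (hsub : ∀ X : 𝒜, T X → MemRightPerp C X) {n : ℕ} {K X : 𝒜} (hK : DimLE T n K) (hX : T X) :
    DimLE T n (K ⊞ X) := by
  have h : (ShortComplex.mk (biprod.inr : X ⟶ K ⊞ X) biprod.fst biprod.inr_fst).ShortExact :=
    shortExact_of_lift _ _ _ fun W t ht ↦ ⟨t ≫ biprod.snd, by
      apply biprod.hom_ext <;> simp [ht]⟩
  exact DimLE.extension hT hpre hsub h hX hK

lemma closedUnderSummands_dimLE (hT : IsAdditiveClass T) (hC : IsAdditiveClass C)
    (hpre : IsPreresolving C T C) (hsub : ∀ X : 𝒜, T X → MemRightPerp C X)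
    (hsum : ClosedUnderSummands T) (n : ℕ) : ClosedUnderSummands (DimLE T n) := by
  induction n with
  | zero => exact hsum
  | succ n ih =>
    intro X Y hXY
    obtain ⟨K, Z, f, g, w, hZ, h, hK⟩ := hXY.exists_generator hT hpre hsub
    have : Epi g := h.epi_g
    have hX := shortExact_kernel (g ≫ biprod.fst)
    have hY := shortExact_kernel (g ≫ biprod.snd)
    have hZZ : C (Z ⊞ Z) := hC.2.2 hZ hZ
    obtain ⟨s, hs⟩ := (eProper_of_memRightPerp h (hK.memRightPerp hsub) _ hZZ).2.2
      (biprod.map (g ≫ biprod.fst) (g ≫ biprod.snd))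
    obtain ⟨e⟩ := schanuel h (shortExact_biprod_map hX hY) s hs (biprod.lift (𝟙 Z) (𝟙 Z))
      (by apply biprod.hom_ext <;> simp)
    have hsummands := ih _ _ (ih _ _ ((hK.biprod hT hpre hsub (hpre.1.1 hZZ)).of_iso hT e)).1
    exact ⟨⟨_, Z, _, _, _, hpre.1.1 hZ, hX, hsummands.1⟩,
      ⟨_, Z, _, _, _, hpre.1.1 hZ, hY, hsummands.2⟩⟩

end Dimension

end RelHomDim

open RelHomDim in
/-- Corollary 3.9. -/
theorem stmt11 {𝒜 : Type u} [Category.{v} 𝒜] [Abelian 𝒜] [HasExt.{w} 𝒜]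
    (𝒯 𝒞 : 𝒜 → Prop) (h𝒯 : IsAdditiveClass 𝒯) (h𝒞 : IsAdditiveClass 𝒞)
    (hpre : IsPreresolving 𝒞 𝒯 𝒞) (hker : ClosedUnderProperKernels 𝒞 𝒯)
    (hsub : ∀ X : 𝒜, 𝒯 X → MemRightPerp 𝒞 X)
    (hsum : ClosedUnderSummands 𝒯) :
    ∀ n : ℕ, ClosedUnderSummands (fun A : 𝒜 => rdim 𝒯 A ≤ (n : ℕ∞)) := by
  intro n X Y h
  simp only [rdim_le_iff h𝒯] at h ⊢
  exact closedUnderSummands_dimLE h𝒯 h𝒞 hpre hsub hsum n X Y h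
end
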